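/- arXiv:1412.8324 — 2 statements merged into one kernel-verified Lean document; each statement's English description precedes it below -/
import Mathlib

section
/- Let ⟨E, ≺⟩ be a countable partially ordered structure such that (a) there exists a finite partition Π = {E_1, …, E_m} of E, and (b) for each E_i ∈ Π, the restriction ≺ ∩ (E_i × E_i) is a well ordering of E_i. Then ≺ can be extended to a well ordering of E. -/
/-- The restriction of a relation to a set. -/
def restrictRel {α : Type*} (r : α → α → Prop) (A : Set α) : α → α → Prop :=
  fun e e' => r e e' ∧ e ∈ A ∧ e' ∈ A

/-- `r` is a (strict) well ordering of the set `A`: it is a linear (total strict)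
ordering of `A` under which every non-empty subset of `A` has a least element. -/
def IsWellOrderOn {α : Type*} (A : Set α) (r : α → α → Prop) : Prop :=
  (∀ a ∈ A, ¬ r a a) ∧
  (∀ a b c, r a b → r b c → r a c) ∧
  (∀ a ∈ A, ∀ b ∈ A, a ≠ b → r a b ∨ r b a) ∧
  (∀ B ⊆ A, B.Nonempty → ∃ m ∈ B, ∀ a ∈ B, a ≠ m → r m a)

theorem IsWellOrderOn.wellFoundedOn {α : Type*} {A : Set α} {r : α → α → Prop}
    (h : IsWellOrderOn A (restrictRel r A)) : A.WellFoundedOn r := by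
  obtain ⟨hirr, htrans, -, hmin⟩ := h
  rw [Set.wellFoundedOn_iff, WellFounded.wellFounded_iff_has_min]
  intro s ⟨a, ha⟩
  by_cases hs : (s ∩ A).Nonempty
  · obtain ⟨m, hm, hlt⟩ := hmin (s ∩ A) Set.inter_subset_right hs
    refine ⟨m, hm.1, fun x hx hxm => ?_⟩
    by_cases hne : x = m
    · subst hne
      exact hirr x hm.2 hxm
    · exact hirr m hm.2 (htrans m x m (hlt x ⟨hx, hxm.2.1⟩ hne) hxm)
  · exact ⟨a, ha, fun x hx hxa => hs ⟨x, hx, hxa.2.1⟩⟩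

theorem IsWellOrder.isWellOrderOn {α : Type*} (s : α → α → Prop) [IsWellOrder α s] (A : Set α) :
    IsWellOrderOn A s := by
  refine ⟨fun a _ => irrefl_of s a, fun _ _ _ => trans_of s, fun a _ b _ hab => ?_,
    fun B _ hB => ?_⟩
  · rcases trichotomous_of s a b with h | h | h
    exacts [Or.inl h, absurd h hab, Or.inr h]
  · obtain ⟨m, hm, hmin⟩ := (IsWellFounded.wf (r := s)).has_min B hB
    refine ⟨m, hm, fun a ha hne => ?_⟩
    rcases trichotomous_of s m a with h | h | h
    exacts [h, absurd h.symm hne, absurd h (hmin a ha)]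

/-- Theorem 1 (order extension): let `⟨E, ≺⟩` be a countable partially ordered
structure admitting a finite partition `P 0, …, P (n-1)` of `E` such that the
restriction of `≺` to each part is a well ordering of that part. Then `≺` can be
extended to a well ordering of `E`. -/
theorem partial_order_extends_to_well_order {α : Type*}
    (E : Set α) (hcount : E.Countable)
    (r : α → α → Prop)
    (hdom : ∀ a b, r a b → a ∈ E ∧ b ∈ E)
    (hirr : ∀ a ∈ E, ¬ r a a)
    (htrans : ∀ a b c, r a b → r b c → r a c)
    (n : ℕ) (P : Fin n → Set α)
    (hne : ∀ i, (P i).Nonempty)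
    (hcover : (⋃ i, P i) = E)
    (hdisj : ∀ i j, i ≠ j → Disjoint (P i) (P j))
    (hwo : ∀ i, IsWellOrderOn (P i) (restrictRel r (P i))) :
    ∃ r' : α → α → Prop, (∀ a b, r a b → r' a b) ∧ IsWellOrderOn E r' := by
  have hstrict : IsStrictOrder α r :=
    { irrefl := fun a h => hirr a (hdom a a h).1 h
      trans := htrans }
  have hE : E.WellFoundedOn r := by
    have h := (Finset.wellFoundedOn_bUnion (r := r) Finset.univ (f := P)).2
      fun i _ => (hwo i).wellFoundedOn
    simpa [hcover] using h
  have hwf : IsWellFounded α r :=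
    ⟨Subrelation.wf (fun h => ⟨h, hdom _ _ h⟩) (Set.wellFoundedOn_iff.1 hE)⟩
  obtain ⟨s, hrs, hs⟩ := IsWellFounded.exists_well_order_ge r
  exact ⟨s, hrs, hs.isWellOrderOn s E⟩
end

section
/- If a history H is linearizable (with respect to a sequential specification for each object), then for each object o, the object subhistory H|o is linearizable. Moreover, if S is a linearization of H with extension H', then S|o is a linearization of H|o with extension H'|o. -/
/-- An event is either an invocation event or a response event, tagged with a
process id, a method-call index, an object id, an operation id, and a payload. -/
inductive Event : Type where
  | inv (proc call obj op : ℕ) (args : List ℕ) : Event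
  | resp (proc call obj op : ℕ) (res : List ℕ) : Event

namespace Event

/-- The process id of an event. -/
def proc : Event → ℕ
  | .inv p _ _ _ _ => p
  | .resp p _ _ _ _ => p

/-- The object id of an event. -/
def obj : Event → ℕ
  | .inv _ _ x _ _ => x
  | .resp _ _ x _ _ => x

/-- Whether an event is an invocation event. -/
def isInv : Event → Prop
  | .inv _ _ _ _ _ => True
  | .resp _ _ _ _ _ => False

/-- Whether an event is a response event. -/
def isResp : Event → Prop
  | .inv _ _ _ _ _ => False
  | .resp _ _ _ _ _ => True

/-- An invocation event and a response event are matching if they agree on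
(process id, method-call index, object id, operation id). -/
def Matching : Event → Event → Prop
  | .inv p j x y _, .resp p' j' x' y' _ => p = p' ∧ j = j' ∧ x = x' ∧ y = y'
  | _, _ => False

end Event

/-- A method call is the ordered pair of its matching invocation and response events. -/
structure MethodCall : Type where
  invEv : Event
  respEv : Event
  matching : Event.Matching invEv respEv

/-- `e` is the least element of `A` under `r`. -/
def IsLeastOn {α : Type*} (A : Set α) (r : α → α → Prop) (e : α) : Prop :=
  e ∈ A ∧ ∀ e' ∈ A, e' ≠ e → r e e'

/-- `e'` is the immediate successor of `e` in `A` under `r`. -/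
def ImmSucc {α : Type*} (A : Set α) (r : α → α → Prop) (e e' : α) : Prop :=
  e ∈ A ∧ e' ∈ A ∧ r e e' ∧ ∀ x ∈ A, ¬ (r e x ∧ r x e')

/-- The structure `⟨A, r⟩` of events is sequential: its least event is an
invocation event, the immediate successor of an invocation event is its matching
response event, and the immediate successor of a response event is an invocation
event. -/
def SeqOn (A : Set Event) (r : Event → Event → Prop) : Prop :=
  (∀ e, IsLeastOn A r e → e.isInv) ∧
  (∀ e e', ImmSucc A r e e' → e.isInv → Event.Matching e e') ∧
  (∀ e e', ImmSucc A r e e' → e.isResp → e'.isInv)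

/-- The raw data of a history: an event set together with an ordering. -/
structure RawHistory : Type where
  E : Set Event
  lt : Event → Event → Prop

namespace RawHistory

/-- The events of `H` generated by process `p`. -/
def procSet (H : RawHistory) (p : ℕ) : Set Event := {e ∈ H.E | e.proc = p}

/-- `H` is a history: a well-ordered countable structure of invocation and
response events that is finitely-partitionable (events are generated by the
finitely many processes and concern the finitely many objects of the system)
and well-formed (every process subhistory is sequential). -/
def IsHistory (H : RawHistory) : Prop :=
  H.E.Countable ∧
  (∀ e e', H.lt e e' → e ∈ H.E ∧ e' ∈ H.E) ∧
  IsWellOrderOn H.E H.lt ∧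
  (Event.proc '' H.E).Finite ∧
  (Event.obj '' H.E).Finite ∧
  (∀ p, SeqOn (H.procSet p) (restrictRel H.lt (H.procSet p)))

/-- The subhistory of `H` induced by a set of events. -/
def restrict (H : RawHistory) (A : Set Event) : RawHistory :=
  ⟨H.E ∩ A, restrictRel H.lt (H.E ∩ A)⟩

/-- The process subhistory `H|p`: the maximal subhistory of `H` whose events
have process id `p`. -/
def byProc (H : RawHistory) (p : ℕ) : RawHistory := H.restrict {e | e.proc = p}

/-- The object subhistory `H|o`: the maximal subhistory of `H` whose events
have object id `o`. -/
def byObj (H : RawHistory) (o : ℕ) : RawHistory := H.restrict {e | e.obj = o}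

/-- An invocation event is pending in `H` if its matching response event is not
in `H`. -/
def Pending (H : RawHistory) (e : Event) : Prop :=
  e ∈ H.E ∧ e.isInv ∧ ∀ e' ∈ H.E, ¬ Event.Matching e e'

/-- `complete H` is the maximal subhistory of `H` containing no pending
invocation events. -/
def complete (H : RawHistory) : RawHistory :=
  H.restrict {e | ¬ H.Pending e}

/-- `H` is complete if `complete H = H`. -/
def IsComplete (H : RawHistory) : Prop := H.complete = H

/-- A method call belongs to `H` if both its events are events of `H`. -/
def MemCall (m : MethodCall) (H : RawHistory) : Prop :=
  m.invEv ∈ H.E ∧ m.respEv ∈ H.E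

/-- The induced ordering on method calls: `m ≺_H m'` iff `resp(m) ≺_H inv(m')`. -/
def callLt (H : RawHistory) (m m' : MethodCall) : Prop :=
  H.lt m.respEv m'.invEv

/-- `H` is a subhistory of `H'`: the event set of `H` is included in that of
`H'` and the ordering of `H` is the restriction of the ordering of `H'`. -/
def Subhistory (H H' : RawHistory) : Prop :=
  H.E ⊆ H'.E ∧ ∀ e e', H.lt e e' ↔ restrictRel H'.lt H.E e e'

/-- The difference `H' − H`: the history on `E_{H'} \ E_H` with the induced
ordering. -/
def diff (H' H : RawHistory) : RawHistory :=
  ⟨H'.E \ H.E, restrictRel H'.lt (H'.E \ H.E)⟩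

/-- `H` is a sequential history. -/
def Sequential (H : RawHistory) : Prop := SeqOn H.E H.lt

/-- `H` and `H'` are equivalent if `H|p = H'|p` for every process `p`. -/
def Equivalent (H H' : RawHistory) : Prop := ∀ p, H.byProc p = H'.byProc p

/-- `H` is a prefix of `H'`: `H` is a subhistory of `H'` and every event of
`H' − H` is above every event of `H`. -/
def IsPrefix (H H' : RawHistory) : Prop :=
  Subhistory H H' ∧ ∀ e ∈ H.E, ∀ e' ∈ (H'.diff H).E, H'.lt e e'

/-- `H` is a single-object history for object `o`. -/
def SingleObject (H : RawHistory) (o : ℕ) : Prop := ∀ e ∈ H.E, e.obj = o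

end RawHistory

open RawHistory

/-- `spec` is a sequential specification for object `o`: a prefix-closed set of
single-object sequential histories for `o`. -/
def IsSeqSpec (o : ℕ) (spec : Set RawHistory) : Prop :=
  (∀ S ∈ spec, S.IsHistory ∧ S.Sequential ∧ S.SingleObject o) ∧
  (∀ S ∈ spec, ∀ S', IsPrefix S' S → S' ∈ spec)

/-- A sequential history `S` is legal w.r.t. the family `spec` of sequential
specifications if it is sequential and each object subhistory `S|o` belongs to
object `o`'s sequential specification. -/
def Legal (spec : ℕ → Set RawHistory) (S : RawHistory) : Prop :=
  S.Sequential ∧ ∀ o, S.byObj o ∈ spec o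

/-- `S` is a linearization of `H` with extension `H'`: `H'` is a history
extending `H` such that `H' − H` contains only response events, `S` is a legal
sequential history equivalent to `complete H'`, and the method-call order of
`complete H'` is preserved in `S`. -/
def IsLinearization (spec : ℕ → Set RawHistory) (H H' S : RawHistory) : Prop :=
  H'.IsHistory ∧ Subhistory H H' ∧ (∀ e ∈ (H'.diff H).E, e.isResp) ∧
  S.IsHistory ∧ Legal spec S ∧ Equivalent H'.complete S ∧
  ∀ m m' : MethodCall, m ≠ m' → callLt H'.complete m m' → callLt S m m'

/-- `H` is linearizable w.r.t. the sequential specifications `spec`. -/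
def Linearizable (spec : ℕ → Set RawHistory) (H : RawHistory) : Prop :=
  ∃ H' S, IsLinearization spec H H' S

namespace Event

theorem Matching.obj_eq {e e' : Event} (h : Matching e e') : e.obj = e'.obj := by
  cases e <;> cases e' <;> simp_all [Matching, obj]

end Event

namespace RawHistory

theorem restrict_restrict (H : RawHistory) (A B : Set Event) :
    (H.restrict A).restrict B = H.restrict (A ∩ B) := by
  simp only [restrict, Set.inter_assoc, mk.injEq, true_and]
  funext e e'
  simp only [restrictRel, Set.mem_inter_iff, eq_iff_iff]
  tauto

theorem restrict_congr (H : RawHistory) {A B : Set Event}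
    (h : ∀ e ∈ H.E, e ∈ A ↔ e ∈ B) : H.restrict A = H.restrict B := by
  have hE : H.E ∩ A = H.E ∩ B := by
    ext e
    exact and_congr_right (h e)
  simp only [restrict, hE]

theorem byObj_byObj (H : RawHistory) (o : ℕ) : (H.byObj o).byObj o = H.byObj o := by
  simp only [byObj, restrict_restrict, Set.inter_self]

theorem byObj_byProc (H : RawHistory) (o p : ℕ) :
    (H.byObj o).byProc p = (H.byProc p).byObj o := by
  simp only [byObj, byProc, restrict_restrict, Set.inter_comm]

theorem pending_byObj_iff (H : RawHistory) (o : ℕ) {e : Event} (he : e.obj = o) :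
    (H.byObj o).Pending e ↔ H.Pending e := by
  constructor
  · rintro ⟨h, hi, hm⟩
    exact ⟨h.1, hi, fun e' he' hee' => hm e' ⟨he', hee'.obj_eq.symm.trans he⟩ hee'⟩
  · rintro ⟨h, hi, hm⟩
    exact ⟨⟨h, he⟩, hi, fun e' he' => hm e' he'.1⟩

theorem complete_byObj (H : RawHistory) (o : ℕ) :
    (H.byObj o).complete = H.complete.byObj o := by
  have h : (H.byObj o).complete = (H.byObj o).restrict {e | ¬ H.Pending e} :=
    restrict_congr _ fun e he => not_congr (H.pending_byObj_iff o he.2)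
  rw [h]
  simp only [complete, byObj, restrict_restrict, Set.inter_comm]

theorem Equivalent.byObj {H H' : RawHistory} (h : Equivalent H H') (o : ℕ) :
    Equivalent (H.byObj o) (H'.byObj o) := fun p => by
  rw [byObj_byProc, byObj_byProc, h p]

theorem Subhistory.byObj {H H' : RawHistory} (h : Subhistory H H') (o : ℕ) :
    Subhistory (H.byObj o) (H'.byObj o) := by
  refine ⟨Set.inter_subset_inter_left _ h.1, fun e e' => ?_⟩
  have h₁ := @h.1 e
  have h₂ := @h.1 e'
  simp only [RawHistory.byObj, restrict, restrictRel, h.2, Set.mem_inter_iff]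
  tauto

theorem byObj_of_ne {H : RawHistory} {o o' : ℕ} (h : o ≠ o') :
    (H.byObj o).byObj o' = ⟨∅, fun _ _ => False⟩ := by
  have hA : H.E ∩ ({e | e.obj = o} ∩ {e | e.obj = o'}) = ∅ := by
    ext e
    simp only [Set.mem_inter_iff, Set.mem_ofPred_eq, Set.mem_empty_iff_false, iff_false]
    rintro ⟨-, rfl, h'⟩
    exact h h'
  simp only [byObj, restrict_restrict]
  simp only [restrict, hA, mk.injEq, true_and]
  funext e e'
  simp [restrictRel]

theorem isPrefix_empty (H : RawHistory) : IsPrefix ⟨∅, fun _ _ => False⟩ H := by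
  simp [IsPrefix, Subhistory, restrictRel]

/-- In a history, the immediate successor of an event within a process subhistory exists
as soon as the event is not the last one. -/
theorem IsHistory.exists_immSucc {H : RawHistory} (hH : H.IsHistory) {p : ℕ} {e e' : Event}
    (he : e ∈ H.procSet p) (he' : e' ∈ H.procSet p) (hlt : H.lt e e') :
    ∃ x, ImmSucc (H.procSet p) (restrictRel H.lt (H.procSet p)) e x := by
  obtain ⟨-, -, ⟨hirr, htr, -, hmin⟩, -⟩ := hH
  obtain ⟨m, ⟨hm, hem⟩, hleast⟩ :=
    hmin {x ∈ H.procSet p | H.lt e x} (fun x hx => hx.1.1) ⟨e', he', hlt⟩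
  refine ⟨m, he, hm, ⟨hem, he, hm⟩, fun x hx hbetween => ?_⟩
  have hxm := hbetween.2.1
  have hne : x ≠ m := by
    rintro rfl
    exact hirr x hx.1 hxm
  exact hirr x hx.1 (htr _ _ _ hxm (hleast x ⟨hx, hbetween.1.1⟩ hne))

/-- Well-formedness of `H|o` does not follow from that of `H` alone, since events at limit
positions are unconstrained; it does follow if the complete part of `H|o` is well-formed. -/
theorem IsHistory.byObj {H : RawHistory} (hH : H.IsHistory) {o : ℕ}
    (hseq : ∀ p, ((H.byObj o).complete.byProc p).Sequential) : (H.byObj o).IsHistory := by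
  have hsub : (H.byObj o).E ⊆ H.E := Set.inter_subset_left
  have hsucc := @hH.exists_immSucc
  obtain ⟨hc, -, ⟨hirr, htr, htot, hmin⟩, hp, ho, hs⟩ := hH
  refine ⟨hc.mono hsub, fun e e' h => h.2, ⟨fun a ha h => hirr a ha.1 h.1,
    fun a b c h h' => ⟨htr _ _ _ h.1 h'.1, h.2.1, h'.2.2⟩, fun a ha b hb hab => ?_,
    fun B hB hne => ?_⟩, hp.subset (Set.image_mono hsub), ho.subset (Set.image_mono hsub),
    fun p => ⟨fun e he => ?_, fun e e' hee' hi => ?_, fun e e' hee' hr => ?_⟩⟩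
  · exact (htot a ha.1 b hb.1 hab).imp (⟨·, ha, hb⟩) (⟨·, hb, ha⟩)
  · obtain ⟨m, hm, hleast⟩ := hmin B (hB.trans hsub) hne
    exact ⟨m, hm, fun a ha hne => ⟨hleast a ha hne, hB hm, hB ha⟩⟩
  · by_cases hpe : (H.byObj o).Pending e
    · exact hpe.2.1
    have hmem : e ∈ ((H.byObj o).complete.byProc p).E := ⟨⟨he.1.1, hpe⟩, he.1.2⟩
    exact (hseq p).1 e ⟨hmem, fun x hx hne =>
      ⟨⟨(he.2 x ⟨hx.1.1, hx.2⟩ hne).1, hmem.1, hx.1⟩, hmem, hx⟩⟩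
  · obtain ⟨h₁, h₂, h₁₂, hno⟩ := hee'
    obtain ⟨x, hx⟩ := hsucc ⟨h₁.1.1, h₁.2⟩ ⟨h₂.1.1, h₂.2⟩ h₁₂.1.1
    have hmatch := (hs p).2.1 e x hx hi
    have hxo : x ∈ (H.byObj o).procSet p :=
      ⟨⟨hx.2.1.1, hmatch.obj_eq.symm.trans h₁.1.2⟩, hx.2.1.2⟩
    by_cases hxe : x = e'
    · exact hxe ▸ hmatch
    rcases htot x hx.2.1.1 e' h₂.1.1 hxe with h | h
    · exact absurd ⟨⟨⟨hx.2.2.1.1, h₁.1, hxo.1⟩, h₁, hxo⟩, ⟨⟨h, hxo.1, h₂.1⟩, hxo, h₂⟩⟩ (hno x hxo)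
    · have he' : e' ∈ H.procSet p := ⟨h₂.1.1, h₂.2⟩
      exact absurd ⟨⟨h₁₂.1.1, hx.1, he'⟩, ⟨h, he', hx.2.1⟩⟩ (hx.2.2.2 e' he')
  · obtain ⟨h₁, h₂, h₁₂, hno⟩ := hee'
    by_cases hpe' : (H.byObj o).Pending e'
    · exact hpe'.2.1
    have hpe : ¬ (H.byObj o).Pending e := fun h => by
      have := h.2.1
      cases e <;> simp_all [Event.isInv, Event.isResp]
    have hm₁ : e ∈ ((H.byObj o).complete.byProc p).E := ⟨⟨h₁.1, hpe⟩, h₁.2⟩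
    have hm₂ : e' ∈ ((H.byObj o).complete.byProc p).E := ⟨⟨h₂.1, hpe'⟩, h₂.2⟩
    refine (hseq p).2.2 e e' ⟨hm₁, hm₂, ⟨⟨h₁₂.1, hm₁.1, hm₂.1⟩, hm₁, hm₂⟩, ?_⟩ hr
    intro x hx hb
    have hxp : x ∈ (H.byObj o).procSet p := ⟨hx.1.1, hx.2⟩
    exact hno x hxp ⟨⟨hb.1.1.1, h₁, hxp⟩, ⟨hb.2.1.1, hxp, h₂⟩⟩

end RawHistory

theorem Legal.byObj {spec : ℕ → Set RawHistory} (hspec : ∀ o, IsSeqSpec o (spec o))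
    {S : RawHistory} (hS : Legal spec S) (o : ℕ) : Legal spec (S.byObj o) := by
  refine ⟨((hspec o).1 _ (hS.2 o)).2.1, fun o' => ?_⟩
  by_cases h : o = o'
  · subst h
    rw [byObj_byObj]
    exact hS.2 o
  · rw [byObj_of_ne h]
    exact (hspec o').2 _ (hS.2 o') _ (isPrefix_empty _)

theorem IsLinearization.byObj {spec : ℕ → Set RawHistory} (hspec : ∀ o, IsSeqSpec o (spec o))
    {H H' S : RawHistory} (h : IsLinearization spec H H' S) (o : ℕ) :
    IsLinearization spec (H.byObj o) (H'.byObj o) (S.byObj o) := by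
  obtain ⟨hH', hsub, hdiff, hS, hleg, heq, hord⟩ := h
  have hSo : (S.byObj o).IsHistory := ((hspec o).1 _ (hleg.2 o)).1
  have heqo : Equivalent (H'.byObj o).complete (S.byObj o) := by
    rw [complete_byObj]
    exact heq.byObj o
  refine ⟨hH'.byObj fun p => ?_, hsub.byObj o,
    fun e he => hdiff e ⟨he.1.1, fun hn => he.2 ⟨hn, he.1.2⟩⟩, hSo, hleg.byObj hspec o, heqo,
    fun m m' hne hlt => ?_⟩
  · rw [heqo p]
    exact hSo.2.2.2.2.2 p
  · rw [complete_byObj] at hlt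
    have hS_lt := hord m m' hne hlt.1
    have hmem := hS.2.1 _ _ hS_lt
    exact ⟨hS_lt, ⟨hmem.1, hlt.2.1.2⟩, ⟨hmem.2, hlt.2.2.2⟩⟩

/-- Lemma 1: if a history `H` is linearizable w.r.t. a sequential specification
for each object, then for each object `o` the object subhistory `H|o` is
linearizable; moreover, if `S` is a linearization of `H` with extension `H'`,
then `S|o` is a linearization of `H|o` with extension `H'|o`. -/
theorem linearizable_implies_object_linearizable
    (spec : ℕ → Set RawHistory) (hspec : ∀ o, IsSeqSpec o (spec o))
    (H : RawHistory) (hH : H.IsHistory) :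
    (Linearizable spec H → ∀ o : ℕ, Linearizable spec (H.byObj o)) ∧
    (∀ H' S : RawHistory, IsLinearization spec H H' S →
      ∀ o : ℕ, IsLinearization spec (H.byObj o) (H'.byObj o) (S.byObj o)) := by
  exact ⟨fun ⟨_, _, h⟩ o => ⟨_, _, h.byObj hspec o⟩, fun _ _ h o => h.byObj hspec o⟩
end
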